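/- arXiv:2405.08927 — 3 statements merged into one kernel-verified Lean document; each statement's English description precedes it below -/
import Mathlib

section
/- Let (X, π) be a weighted simplicial complex of rank n and let ω̂ be a face with |ω̂| ≤ n−2. Then for Φ(t) = t², the local Φ-entropy contraction constant equals lc_Φ(ω̂) = 1/(n−|ω̂|) + ((n−|ω̂|−1)/(n−|ω̂|)) · λ₂(M_ω̂), where M_ω̂ is the link random-walk matrix of ω̂. -/
open scoped Classical
noncomputable section

namespace Expanderized

/-! ## Generic weighted linear algebra over finite types -/

section Generic

variable {α β γ : Type*}

/-- Inner product `⟨f,g⟩_μ = E_{x∼μ}[f(x)g(x)]` with respect to a weight `μ`. -/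
def inner' [Fintype α] (μ : α → ℝ) (f g : α → ℝ) : ℝ := ∑ x, μ x * (f x * g x)

/-- Expectation with respect to `μ`. -/
def expect [Fintype α] (μ : α → ℝ) (f : α → ℝ) : ℝ := ∑ x, μ x * f x

/-- `μ` is a probability distribution. -/
def IsProbDist [Fintype α] (μ : α → ℝ) : Prop := (∀ x, 0 ≤ μ x) ∧ (∑ x, μ x) = 1

/-- A row-stochastic kernel. -/
def IsRowStochastic [Fintype β] (P : α → β → ℝ) : Prop :=
  (∀ x y, 0 ≤ P x y) ∧ ∀ x, (∑ y, P x y) = 1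

/-- Product of two kernels (matrix multiplication). -/
def matMul [Fintype β] (A : α → β → ℝ) (B : β → γ → ℝ) : α → γ → ℝ :=
  fun x z => ∑ y, A x y * B y z

/-- Right action of a kernel on a function (column vector). -/
def mApp [Fintype β] (A : α → β → ℝ) (f : β → ℝ) : α → ℝ :=
  fun x => ∑ y, A x y * f y

/-- Left action of a kernel on a row vector / measure. -/
def rowMul [Fintype α] (μ : α → ℝ) (A : α → β → ℝ) : β → ℝ :=
  fun y => ∑ x, μ x * A x y

/-- The adjoint of the kernel `P` with respect to the measures `(μ₁, μ₂)`. -/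
def adjointKer [Fintype α] [Fintype β] (μ₁ : α → ℝ) (μ₂ : β → ℝ) (P : α → β → ℝ) :
    β → α → ℝ :=
  fun y x => P x y * μ₁ x / μ₂ y

/-- Iterates of a square kernel. -/
def matIter [Fintype α] [DecidableEq α] (A : α → α → ℝ) : ℕ → (α → α → ℝ)
  | 0 => fun x y => if x = y then 1 else 0
  | (t + 1) => matMul (matIter A t) A

/-- The second-largest eigenvalue `λ₂` of a random walk matrix that is reversible
with respect to `μ`, via its Rayleigh-quotient (Courant–Fischer) characterization. -/
def lambda2 [Fintype α] (μ : α → ℝ) (A : α → α → ℝ) : ℝ :=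
  sSup {r | ∃ f : α → ℝ, inner' μ f f = 1 ∧ inner' μ f (fun _ => 1) = 0 ∧
      r = inner' μ f (mApp A f)}

/-- The spectral gap `1 - λ₂`. -/
def specGap [Fintype α] (μ : α → ℝ) (A : α → α → ℝ) : ℝ := 1 - lambda2 μ A

/-- The two-sided expansion `λ(A) = max(λ₂(A), |λ_min(A)|)` of a random walk matrix
reversible with respect to `μ`, via its Rayleigh-quotient characterization. -/
def twoSided [Fintype α] (μ : α → ℝ) (A : α → α → ℝ) : ℝ :=
  sSup {r | ∃ f : α → ℝ, inner' μ f f = 1 ∧ inner' μ f (fun _ => 1) = 0 ∧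
      r = |inner' μ f (mApp A f)|}

/-- The operator norm `‖A‖_{op,μ}`. -/
def opNorm [Fintype α] (μ : α → ℝ) (A : α → α → ℝ) : ℝ :=
  sSup {r | ∃ f : α → ℝ, inner' μ f f = 1 ∧
      r = Real.sqrt (inner' μ (mApp A f) (mApp A f))}

/-- The `Φ`-entropy functional `Ent^Φ_μ(f) = E_μ[Φ(f)] - Φ(E_μ f)`. -/
def phiEnt [Fintype α] (Φ : ℝ → ℝ) (μ : α → ℝ) (f : α → ℝ) : ℝ :=
  expect μ (fun x => Φ (f x)) - Φ (expect μ f)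

/-- `t ↦ t log t`; note `Real.log 0 = 0`, so the convention `0 log 0 = 0` is built in. -/
def nlog (t : ℝ) : ℝ := t * Real.log t

/-- The usual entropy functional `Ent_μ`. -/
def ent [Fintype α] (μ : α → ℝ) (f : α → ℝ) : ℝ := phiEnt nlog μ f

/-- The `Φ`-entropy contraction constant of a kernel `P` with respect to measures
`(μ₁, μ₂)`: the largest `C ≥ 0` such that `Ent^Φ_{μ₁}(Pf) ≤ (1-C)·Ent^Φ_{μ₂}(f)`
for all nonnegative `f`. -/
def CFphi [Fintype α] [Fintype β] (Φ : ℝ → ℝ) (μ₁ : α → ℝ) (μ₂ : β → ℝ)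
    (P : α → β → ℝ) : ℝ :=
  sSup {C | 0 ≤ C ∧ ∀ f : β → ℝ, (∀ y, 0 ≤ f y) →
      phiEnt Φ μ₁ (mApp P f) ≤ (1 - C) * phiEnt Φ μ₂ f}

/-- The entropy contraction constant `EC(P)`. -/
def EC [Fintype α] [Fintype β] (μ₁ : α → ℝ) (μ₂ : β → ℝ) (P : α → β → ℝ) : ℝ :=
  CFphi nlog μ₁ μ₂ P

/-- The log-Sobolev constant of a reversible kernel `P` with stationary measure `μ`:
the largest `C ≥ 0` with `C·Ent_μ(f²) ≤ ⟨f,(I-P)f⟩_μ` for all nonnegative `f`. -/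
def LS [Fintype α] (μ : α → ℝ) (P : α → α → ℝ) : ℝ :=
  sSup {C | 0 ≤ C ∧ ∀ f : α → ℝ, (∀ x, 0 ≤ f x) →
      C * ent μ (fun x => f x ^ 2) ≤ inner' μ f (fun x => f x - mApp P f x)}

/-- The modified log-Sobolev constant of a reversible kernel `P` with stationary
measure `μ`: the largest `C ≥ 0` with `C·Ent_μ(f) ≤ ⟨f,(I-P) log f⟩_μ`
for all strictly positive `f`. -/
def MLS [Fintype α] (μ : α → ℝ) (P : α → α → ℝ) : ℝ :=
  sSup {C | 0 ≤ C ∧ ∀ f : α → ℝ, (∀ x, 0 < f x) →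
      C * ent μ f ≤
        inner' μ f (fun x => Real.log (f x) - mApp P (fun y => Real.log (f y)) x)}

/-- Total variation distance. -/
def tvDist [Fintype α] (μ ν : α → ℝ) : ℝ := (∑ x, |μ x - ν x|) / 2

/-- The `ε`-mixing time of a kernel `P` towards the target distribution `π`. -/
def mixingTime [Fintype α] [DecidableEq α] (P : α → α → ℝ) (π : α → ℝ) (ε : ℝ) : ℕ :=
  sInf {t : ℕ | ∀ μ₀ : α → ℝ, IsProbDist μ₀ → tvDist (rowMul μ₀ (matIter P t)) π ≤ ε}

end Generic

/-! ## Weighted simplicial complexes -/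

/-- A weighted (pure) simplicial complex of rank `n` on a finite vertex set `V`:
a downward-closed collection of faces, all maximal faces of cardinality `n`,
together with a fully supported probability distribution `pi` on the rank `n` faces
(extended by zero to all finsets). -/
structure WComplex (V : Type*) [Fintype V] [DecidableEq V] (n : ℕ) where
  faces : Finset (Finset V)
  pi : Finset V → ℝ
  faces_nonempty : faces.Nonempty
  down_closed : ∀ α ∈ faces, ∀ β ⊆ α, β ∈ faces
  card_le : ∀ α ∈ faces, α.card ≤ n
  pure : ∀ α ∈ faces, ∃ ω ∈ faces, ω.card = n ∧ α ⊆ ω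
  pi_pos : ∀ ω ∈ faces, ω.card = n → 0 < pi ω
  pi_zero_of_not_mem : ∀ ω : Finset V, ω ∉ faces → pi ω = 0
  pi_zero_of_card_ne : ∀ ω : Finset V, ω.card ≠ n → pi ω = 0
  pi_sum : (∑ ω : Finset V, pi ω) = 1

namespace WComplex

variable {V : Type*} [Fintype V] [DecidableEq V] {n : ℕ}

/-- `Pr_{ω∼π}[ω ⊇ α]` (unnormalized level mass of a face). -/
def mass (K : WComplex V n) (α : Finset V) : ℝ :=
  ∑ ω : Finset V, if α ⊆ ω then K.pi ω else 0

/-- The induced distribution `π_j` on the `j`-th level `X^(j)`. -/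
def level (K : WComplex V n) (j : ℕ) : Finset V → ℝ :=
  fun α => if α.card = j then ((n.choose j : ℝ))⁻¹ * K.mass α else 0

/-- The up-walk `Up_{ℓ→k}`. -/
def up (K : WComplex V n) (ℓ k : ℕ) : Finset V → Finset V → ℝ :=
  fun a b =>
    if a.card = ℓ ∧ b.card = k ∧ a ⊆ b then
      (((n - ℓ).choose (k - ℓ) : ℝ))⁻¹ * (K.mass b / K.mass a)
    else 0

/-- The down-walk `Down_{k→ℓ}`. -/
def down (K : WComplex V n) (k ℓ : ℕ) : Finset V → Finset V → ℝ :=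
  fun a b => if a.card = k ∧ b.card = ℓ ∧ b ⊆ a then ((k.choose ℓ : ℝ))⁻¹ else 0

/-- The down-up walk `Duw_{n↔ℓ} = Down_{n→ℓ}·Up_{ℓ→n}` on `X^(n)`. -/
def downUp (K : WComplex V n) (ℓ : ℕ) : Finset V → Finset V → ℝ :=
  matMul (K.down n ℓ) (K.up ℓ n)

/-- The up-down walk `Udw_{ℓ↔n} = Up_{ℓ→n}·Down_{n→ℓ}` on `X^(ℓ)`. -/
def upDown (K : WComplex V n) (ℓ : ℕ) : Finset V → Finset V → ℝ :=
  matMul (K.up ℓ n) (K.down n ℓ)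

/-- The top-level distribution `π^(ω̂)` of the link complex of the face `z`. -/
def linkPi (K : WComplex V n) (z : Finset V) : Finset V → ℝ :=
  fun α => if Disjoint α z then K.pi (z ∪ α) / K.mass z else 0

/-- Unnormalized level mass in the link of `z`. -/
def linkMass (K : WComplex V n) (z α : Finset V) : ℝ :=
  ∑ β : Finset V, if α ⊆ β then K.linkPi z β else 0

/-- The induced distribution `π^(ω̂)_j` on the `j`-th level of the link of `z`. -/
def linkLevel (K : WComplex V n) (z : Finset V) (j : ℕ) : Finset V → ℝ :=
  fun α => if α.card = j then (((n - z.card).choose j : ℝ))⁻¹ * K.linkMass z α else 0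

/-- The up-walk `Up^{ω̂}_{ℓ→k}` of the link complex of `z`. -/
def linkUp (K : WComplex V n) (z : Finset V) (ℓ k : ℕ) : Finset V → Finset V → ℝ :=
  fun a b =>
    if a.card = ℓ ∧ b.card = k ∧ a ⊆ b then
      ((((n - z.card) - ℓ).choose (k - ℓ) : ℝ))⁻¹ * (K.linkMass z b / K.linkMass z a)
    else 0

/-- The vertex marginal `π^(ω̂)_1` of the link of `z`, as a distribution on vertices. -/
def linkVertex (K : WComplex V n) (z : Finset V) : V → ℝ :=
  fun x => K.linkLevel z 1 {x}

/-- The link random-walk matrix `M_ω̂` of a face `z` (with `|z| ≤ n-2`). -/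
def linkMat (K : WComplex V n) (z : Finset V) : V → V → ℝ :=
  fun x y =>
    if x ≠ y then (K.mass (z ∪ {x, y}) / K.mass (z ∪ {x})) / ((n : ℝ) - z.card - 1)
    else 0

/-- The local `Φ`-entropy contraction constant `lc_Φ(ω̂)`: the smallest `c ≥ 0` with
`Ent^Φ_{π^(ω̂)_1}(Up^{ω̂}_{1→n'} g) ≤ c·Ent^Φ_{π^(ω̂)_{n'}}(g)` for all `g ≥ 0`,
where `n' = n - |ω̂|`. -/
def lcPhi (K : WComplex V n) (Φ : ℝ → ℝ) (z : Finset V) : ℝ :=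
  sInf {c | 0 ≤ c ∧ ∀ g : Finset V → ℝ, (∀ x, 0 ≤ g x) →
      phiEnt Φ (K.linkLevel z 1) (mApp (K.linkUp z 1 (n - z.card)) g)
        ≤ c * phiEnt Φ (K.linkLevel z (n - z.card)) g}

/-- The local entropy contraction constant `lec(ω̂)` (the case `Φ(t) = t log t`). -/
def lec (K : WComplex V n) (z : Finset V) : ℝ := K.lcPhi nlog z

end WComplex

/-! ## Partite complexes, auxiliary expander graphs, and expanderized walks -/

section Partite

variable {n : ℕ} {U : Type*} [Fintype U] [DecidableEq U]

/-- The type of a face of an `n`-partite complex: the set of sides it meets. -/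
def typ (α : Finset (Fin n × U)) : Finset (Fin n) := α.image Prod.fst

/-- The restriction `ω_S` of a face to the sides in `S`. -/
def restrict (ω : Finset (Fin n × U)) (S : Finset (Fin n)) : Finset (Fin n × U) :=
  ω.filter fun v => v.1 ∈ S

/-- An `n`-partite complex: every facet contains exactly one vertex from each side. -/
def IsPartite (K : WComplex (Fin n × U) n) : Prop :=
  ∀ ω ∈ K.faces, ω.card = n → (typ ω).card = n

/-- `H` is a `k`-regular graph all of whose edges join `ℓ`-element subsets of `[n]`. -/
def IsRegularOnSubsets (H : SimpleGraph (Finset (Fin n))) (ℓ k : ℕ) : Prop :=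
  (∀ S T, H.Adj S T → S.card = ℓ ∧ T.card = ℓ) ∧
  (∀ S : Finset (Fin n), S.card = ℓ → (Finset.univ.filter fun T => H.Adj S T).card = k)

/-- The simple random walk matrix of a `k`-regular graph `H`. -/
def walkMat (H : SimpleGraph (Finset (Fin n))) (k : ℕ) :
    Finset (Fin n) → Finset (Fin n) → ℝ :=
  fun S T => if H.Adj S T then (k : ℝ)⁻¹ else 0

/-- The uniform distribution on `ℓ`-element subsets of `[n]`. -/
def unifSubsets (n ℓ : ℕ) : Finset (Fin n) → ℝ :=
  fun S => if S.card = ℓ then ((n.choose ℓ : ℝ))⁻¹ else 0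

/-- The two-sided expansion `λ(H)` of `H`. -/
def lamH (H : SimpleGraph (Finset (Fin n))) (ℓ k : ℕ) : ℝ :=
  twoSided (unifSubsets n ℓ) (walkMat H k)

/-- The two-sided expansion `λ(H²)` of the square of `H` (i.e. of the graph whose
random walk matrix is the square of that of `H`). -/
def lamHsq (H : SimpleGraph (Finset (Fin n))) (ℓ k : ℕ) : ℝ :=
  twoSided (unifSubsets n ℓ) (matMul (walkMat H k) (walkMat H k))

/-- `Pr_{ω∼π}[ω_{typ a} = a ∧ ω_{typ b} = b]`. -/
def jointMass (K : WComplex (Fin n × U) n) (a b : Finset (Fin n × U)) : ℝ :=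
  ∑ ω : Finset (Fin n × U),
    if restrict ω (typ a) = a ∧ restrict ω (typ b) = b then K.pi ω else 0

/-- The expanderized up-down walk with type-transition matrix `W`; taking
`W = walkMat H k` gives `UpDown(X, π, H)`, and taking `W = (walkMat H k)²`
gives `UpDown(X, π, H²)`.  Its `(ω̂, ω̃)` entry is
`W(typ ω̂, typ ω̃) · Pr_{ω∼π}[ω_{typ ω̃} = ω̃ ∣ ω_{typ ω̂} = ω̂]`. -/
def expUpDown (K : WComplex (Fin n × U) n)
    (W : Finset (Fin n) → Finset (Fin n) → ℝ) :
    Finset (Fin n × U) → Finset (Fin n × U) → ℝ :=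
  fun a b => W (typ a) (typ b) * (jointMass K a b / jointMass K a a)

/-- The expanderized down-walk `Qdo` from `X^(n) × binom([n],ℓ)` to `X^(ℓ)`. -/
def Qdown (K : WComplex (Fin n × U) n) (H : SimpleGraph (Finset (Fin n))) (k : ℕ) :
    Finset (Fin n × U) × Finset (Fin n) → Finset (Fin n × U) → ℝ :=
  fun p b => if H.Adj p.2 (typ b) ∧ b ⊆ p.1 then (k : ℝ)⁻¹ else 0

/-- The expanderized up-walk `Qup` from `X^(ℓ)` to `X^(n) × binom([n],ℓ)`
(the adjoint of `Qdown` with respect to `(π_n ⊗ Unif, π_ℓ)`). -/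
def Qup (K : WComplex (Fin n × U) n) (H : SimpleGraph (Finset (Fin n))) (k : ℕ) :
    Finset (Fin n × U) → Finset (Fin n × U) × Finset (Fin n) → ℝ :=
  fun b p =>
    (if H.Adj p.2 (typ b) then (k : ℝ)⁻¹ else 0) *
      ((if b ⊆ p.1 then K.pi p.1 else 0) / K.mass b)

/-- The expanderized down-up walk `Paqx = Qdo·Qup` on `X^(n) × binom([n],ℓ)`. -/
def expDownUp (K : WComplex (Fin n × U) n) (H : SimpleGraph (Finset (Fin n))) (k : ℕ) :
    Finset (Fin n × U) × Finset (Fin n) → Finset (Fin n × U) × Finset (Fin n) → ℝ :=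
  matMul (Qdown K H k) (Qup K H k)

/-- The product distribution `π_n ⊗ Unif_{binom([n],ℓ)}`. -/
def prodDist (K : WComplex (Fin n × U) n) (ℓ : ℕ) :
    Finset (Fin n × U) × Finset (Fin n) → ℝ :=
  fun p => K.pi p.1 * unifSubsets n ℓ p.2

end Partite

/-! ## List colorings -/

section Coloring

variable {n : ℕ} {Col : Type*} [Fintype Col] [DecidableEq Col]

/-- The degree of a vertex in a graph. -/
def degree' {W : Type*} [Fintype W] (G : SimpleGraph W) (v : W) : ℕ :=
  (Finset.univ.filter fun u => G.Adj v u).card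

/-- A proper list coloring of `(G, L)`. -/
def IsProperColoring (G : SimpleGraph (Fin n)) (L : Fin n → Finset Col)
    (c : Fin n → Col) : Prop :=
  (∀ v, c v ∈ L v) ∧ ∀ u v, G.Adj u v → c u ≠ c v

/-- The face `{(v, c v) : v}` associated to a coloring `c`. -/
def colorFace (c : Fin n → Col) : Finset (Fin n × Col) :=
  Finset.univ.image fun v => (v, c v)

/-- `Y` is the list-coloring complex of `(G, L)`: its faces are the subsets of proper
list colorings and its weight is the uniform distribution on proper list colorings. -/
def IsColoringComplex (G : SimpleGraph (Fin n)) (L : Fin n → Finset Col)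
    (Y : WComplex (Fin n × Col) n) : Prop :=
  (∀ α : Finset (Fin n × Col),
      α ∈ Y.faces ↔ ∃ c : Fin n → Col, IsProperColoring G L c ∧ α ⊆ colorFace c) ∧
  (∀ ω : Finset (Fin n × Col),
      Y.pi ω =
        ∑ c : Fin n → Col,
          if IsProperColoring G L c ∧ ω = colorFace c then
            ((Finset.univ.filter fun c' : Fin n → Col =>
                IsProperColoring G L c').card : ℝ)⁻¹
          else 0)

end Coloring

/-! ## Ising models -/

section Ising

variable {n : ℕ}

/-- `±1` value of a Boolean spin. -/
def signR (b : Bool) : ℝ := if b then 1 else -1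

/-- The (unnormalized) Ising weight `exp(½⟨x,Jx⟩ + ⟨h,x⟩)`. -/
def isingWeight (J : Matrix (Fin n) (Fin n) ℝ) (h : Fin n → ℝ) (x : Fin n → Bool) : ℝ :=
  Real.exp ((1 / 2) * (∑ i, ∑ j, J i j * (signR (x i) * signR (x j))) +
    ∑ i, h i * signR (x i))

/-- The face `{(i, x i) : i}` associated to a spin configuration `x`. -/
def spinFace (x : Fin n → Bool) : Finset (Fin n × Bool) :=
  Finset.univ.image fun i => (i, x i)

/-- `Y` is the Ising complex of `(J, h)`. -/
def IsIsingComplex (J : Matrix (Fin n) (Fin n) ℝ) (h : Fin n → ℝ)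
    (Y : WComplex (Fin n × Bool) n) : Prop :=
  (∀ α : Finset (Fin n × Bool), α ∈ Y.faces ↔ ∃ x : Fin n → Bool, α ⊆ spinFace x) ∧
  (∀ ω : Finset (Fin n × Bool),
      Y.pi ω =
        (∑ x : Fin n → Bool, if ω = spinFace x then isingWeight J h x else 0) /
          ∑ x : Fin n → Bool, isingWeight J h x)

/-- The `ℓ₂ → ℓ₂` operator norm of a square matrix. -/
def matOpNorm {m : ℕ} (J : Matrix (Fin m) (Fin m) ℝ) : ℝ :=
  sSup {r | ∃ v : Fin m → ℝ, (∑ i, v i ^ 2) = 1 ∧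
      r = Real.sqrt (∑ i, (J.mulVec v i) ^ 2)}

/-- The `2×2` principal submatrix of `J` at rows/columns `i, j`. -/
def principal2 (J : Matrix (Fin n) (Fin n) ℝ) (i j : Fin n) : Matrix (Fin 2) (Fin 2) ℝ :=
  !![J i i, J i j; J j i, J j j]

/-- `‖h‖_∞`. -/
def normInf (h : Fin n → ℝ) : ℝ := sSup (Set.range fun i => |h i|)

/-- `‖h‖_₁`. -/
def norm1 (h : Fin n → ℝ) : ℝ := ∑ i, |h i|

end Ising

end Expanderized

namespace Expanderized

section Coupling

variable {α β : Type*} [Fintype α] [Fintype β]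

lemma inner'_sq_le {μ : α → ℝ} (hμ : ∀ x, 0 ≤ μ x) (f g : α → ℝ) :
    inner' μ f g ^ 2 ≤ inner' μ f f * inner' μ g g := by
  refine Finset.sum_sq_le_sum_mul_sum_of_sq_le_mul _ (fun x _ => ?_) (fun x _ => ?_)
    (fun x _ => le_of_eq (by ring))
  · exact mul_nonneg (hμ x) (mul_self_nonneg _)
  · exact mul_nonneg (hμ x) (mul_self_nonneg _)

lemma inner'_self_nonneg {μ : α → ℝ} (hμ : ∀ x, 0 ≤ μ x) (f : α → ℝ) :
    0 ≤ inner' μ f f :=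
  Finset.sum_nonneg fun x _ => mul_nonneg (hμ x) (mul_self_nonneg _)

lemma inner'_smul_left (μ : α → ℝ) (t : ℝ) (f g : α → ℝ) :
    inner' μ (fun x => t * f x) g = t * inner' μ f g := by
  simp only [inner', Finset.mul_sum]
  exact Finset.sum_congr rfl fun x _ => by ring

lemma inner'_comm (μ : α → ℝ) (f g : α → ℝ) : inner' μ f g = inner' μ g f := by
  simp only [inner', mul_comm (f _)]

lemma inner'_smul_smul (μ : α → ℝ) (t : ℝ) (f : α → ℝ) :
    inner' μ (fun x => t * f x) (fun x => t * f x) = t * t * inner' μ f f := by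
  rw [inner'_smul_left, inner'_comm μ f (fun x => t * f x), inner'_smul_left, mul_assoc]

lemma inner'_sub_const (μ : α → ℝ) (f g : α → ℝ) (m : ℝ) :
    inner' μ f (fun x => g x - m) = inner' μ f g - m * inner' μ f (fun _ => 1) := by
  simp only [inner', Finset.mul_sum, ← Finset.sum_sub_distrib]
  exact Finset.sum_congr rfl fun x _ => by ring

lemma phiEnt_sq (μ f : α → ℝ) :
    phiEnt (fun t => t ^ 2) μ f = inner' μ f f - inner' μ f (fun _ => 1) ^ 2 := by
  simp [phiEnt, expect, inner', sq]

lemma inner'_sub_const_sub_const {μ : α → ℝ} (hμ : ∑ x, μ x = 1) (f : α → ℝ) (m : ℝ) :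
    inner' μ (fun x => f x - m) (fun x => f x - m) =
      inner' μ f f - 2 * m * inner' μ f (fun _ => 1) + m ^ 2 := by
  have h : m ^ 2 = ∑ x, m ^ 2 * μ x := by rw [← Finset.mul_sum, hμ, mul_one]
  rw [h]
  simp only [inner', Finset.mul_sum, ← Finset.sum_sub_distrib, ← Finset.sum_add_distrib]
  exact Finset.sum_congr rfl fun x _ => by ring

lemma inner'_centered {μ : α → ℝ} (hμ : ∑ x, μ x = 1) (f : α → ℝ) :
    inner' μ (fun x => f x - inner' μ f (fun _ => 1))
      (fun x => f x - inner' μ f (fun _ => 1)) = phiEnt (fun t => t ^ 2) μ f := by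
  rw [phiEnt_sq, inner'_sub_const_sub_const hμ]
  ring

lemma exists_normalized_mean_zero {μ : α → ℝ} (hμ : ∀ x, 0 ≤ μ x) {x y : α} (hxy : x ≠ y)
    (hx : 0 < μ x) (hy : 0 < μ y) :
    ∃ f : α → ℝ, inner' μ f f = 1 ∧ inner' μ f (fun _ => 1) = 0 := by
  set f : α → ℝ := fun v => if v = x then μ y else if v = y then -μ x else 0 with hf
  have hmean : inner' μ f (fun _ => 1) = 0 := by
    have e : ∀ v, μ v * (f v * 1) =
        (if v = x then μ v * μ y else 0) - (if v = y then μ v * μ x else 0) := by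
      intro v
      by_cases h1 : v = x
      · subst h1; simp [hf, hxy]
      · by_cases h2 : v = y <;> simp [hf, h1, h2, hxy.symm]
    simp only [inner', e, Finset.sum_sub_distrib, Finset.sum_ite_eq', Finset.mem_univ, if_true]
    ring
  have hpos : 0 < inner' μ f f := by
    refine Finset.sum_pos' (fun v _ => mul_nonneg (hμ v) (mul_self_nonneg _))
      ⟨x, Finset.mem_univ _, ?_⟩
    simp only [hf, if_true]
    positivity
  refine ⟨fun v => (Real.sqrt (inner' μ f f))⁻¹ * f v, ?_, ?_⟩
  · rw [inner'_smul_smul, ← mul_inv,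
      Real.mul_self_sqrt hpos.le, inv_mul_cancel₀ hpos.ne']
  · rw [inner'_smul_left, hmean, mul_zero]

/-- For the two conditional expectation operators `U`, `D` of a coupling `w` of `μ` and `ν`,
the optimal variance contraction constant of `U` is the largest value of `‖D f‖²` over
normalized mean-zero functions `f`. -/
theorem isLUB_norm_sq_sInf_variance_contraction
    {w : α → β → ℝ} {μ : α → ℝ} {ν : β → ℝ}
    {U : (β → ℝ) → α → ℝ} {D : (α → ℝ) → β → ℝ}
    (hw : ∀ x b, 0 ≤ w x b) (hμ : ∀ x, ∑ b, w x b = μ x) (hν : ∀ b, ∑ x, w x b = ν b)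
    (hsum : ∑ b, ν b = 1)
    (hU : ∀ g x, μ x * U g x = ∑ b, w x b * g b)
    (hD : ∀ f b, ν b * D f b = ∑ x, w x b * f x)
    (hne : ∃ f : α → ℝ, inner' μ f f = 1 ∧ inner' μ f (fun _ => 1) = 0) :
    IsLUB {r | ∃ f : α → ℝ, inner' μ f f = 1 ∧ inner' μ f (fun _ => 1) = 0 ∧
        r = inner' ν (D f) (D f)}
      (sInf {c | 0 ≤ c ∧ ∀ g : β → ℝ, phiEnt (fun t => t ^ 2) μ (U g) ≤
        c * phiEnt (fun t => t ^ 2) ν g}) := by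
  set S := {r | ∃ f : α → ℝ, inner' μ f f = 1 ∧ inner' μ f (fun _ => 1) = 0 ∧
        r = inner' ν (D f) (D f)}
  have hμ0 : ∀ x, 0 ≤ μ x := fun x => hμ x ▸ Finset.sum_nonneg fun b _ => hw x b
  have hν0 : ∀ b, 0 ≤ ν b := fun b => hν b ▸ Finset.sum_nonneg fun x _ => hw x b
  have hμsum : ∑ x, μ x = 1 := by
    rw [← hsum]
    simp only [← hμ, ← hν]
    exact Finset.sum_comm
  have adj : ∀ f g, inner' μ f (U g) = inner' ν (D f) g := by
    intro f g
    have e1 : inner' μ f (U g) = ∑ x, ∑ b, w x b * (f x * g b) := by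
      refine Finset.sum_congr rfl fun x _ => ?_
      rw [mul_left_comm, hU, Finset.mul_sum]
      exact Finset.sum_congr rfl fun b _ => by ring
    have e2 : inner' ν (D f) g = ∑ b, ∑ x, w x b * (f x * g b) := by
      refine Finset.sum_congr rfl fun b _ => ?_
      rw [← mul_assoc, hD, Finset.sum_mul]
      exact Finset.sum_congr rfl fun b _ => by ring
    rw [e1, e2, Finset.sum_comm]
  have meanD : ∀ f, inner' ν (D f) (fun _ => 1) = inner' μ f (fun _ => 1) := by
    intro f
    simp only [inner', mul_one, hD, ← hμ, Finset.sum_mul]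
    exact Finset.sum_comm
  have meanU : ∀ g, inner' μ (U g) (fun _ => 1) = inner' ν g (fun _ => 1) := by
    intro g
    simp only [inner', mul_one, hU, ← hν, Finset.sum_mul]
    exact Finset.sum_comm
  have jensen : ∀ f, inner' ν (D f) (D f) ≤ inner' μ f f := by
    intro f
    have e : inner' μ f f = ∑ b, ∑ x, w x b * (f x * f x) := by
      simp only [inner', ← hμ, Finset.sum_mul]
      exact Finset.sum_comm
    rw [e]
    refine Finset.sum_le_sum fun b _ => ?_
    have h0 : 0 ≤ ∑ x, w x b * (f x - D f b) ^ 2 :=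
      Finset.sum_nonneg fun x _ => mul_nonneg (hw x b) (sq_nonneg _)
    have e2 : ∑ x, w x b * (f x - D f b) ^ 2 =
        ∑ x, w x b * (f x * f x) - 2 * D f b * (∑ x, w x b * f x)
          + D f b ^ 2 * ∑ x, w x b := by
      simp only [Finset.mul_sum, ← Finset.sum_sub_distrib, ← Finset.sum_add_distrib]
      exact Finset.sum_congr rfl fun x _ => by ring
    rw [e2, ← hD f b, hν] at h0
    linarith
  have hSbdd : BddAbove S := ⟨1, by rintro r ⟨f, h1, -, rfl⟩; exact h1 ▸ jensen f⟩
  have hSne : S.Nonempty := by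
    obtain ⟨f, h1, h2⟩ := hne
    exact ⟨_, f, h1, h2, rfl⟩
  have hρ0 : 0 ≤ sSup S := by
    obtain ⟨f, h1, h2⟩ := hne
    exact (inner'_self_nonneg hν0 (D f)).trans (le_csSup hSbdd ⟨f, h1, h2, rfl⟩)
  have hrayleigh : ∀ f, inner' μ f (fun _ => 1) = 0 →
      inner' ν (D f) (D f) ≤ sSup S * inner' μ f f := by
    intro f hf
    rcases (inner'_self_nonneg hμ0 f).eq_or_lt with h | h
    · rw [← h, mul_zero, h]
      exact jensen f
    · set t := (Real.sqrt (inner' μ f f))⁻¹ with ht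
      have ht2 : t * t * inner' μ f f = 1 := by
        rw [ht, ← mul_inv, Real.mul_self_sqrt h.le, inv_mul_cancel₀ h.ne']
      have hDt : inner' ν (D fun x => t * f x) (D fun x => t * f x) =
          t * t * inner' ν (D f) (D f) := by
        refine (Finset.sum_congr rfl fun b _ => ?_).trans (Finset.mul_sum ..).symm
        have e : ν b * D (fun x => t * f x) b = ν b * (t * D f b) := by
          rw [mul_left_comm, hD, hD, Finset.mul_sum]
          exact Finset.sum_congr rfl fun x _ => by ring
        by_cases hb : ν b = 0
        · simp [hb]
        · rw [mul_left_cancel₀ hb e]; ring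
      have hmem : t * t * inner' ν (D f) (D f) ∈ S := by
        refine ⟨fun x => t * f x, ?_, ?_, hDt.symm⟩
        · rw [inner'_smul_smul, ht2]
        · rw [inner'_smul_left, hf, mul_zero]
      have := mul_le_mul_of_nonneg_right (le_csSup hSbdd hmem) h.le
      calc inner' ν (D f) (D f)
          = t * t * inner' μ f f * inner' ν (D f) (D f) := by rw [ht2, one_mul]
        _ = t * t * inner' ν (D f) (D f) * inner' μ f f := by ring
        _ ≤ _ := this
  have hmemρ : sSup S ∈ {c | 0 ≤ c ∧ ∀ g : β → ℝ, phiEnt (fun t => t ^ 2) μ (U g) ≤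
        c * phiEnt (fun t => t ^ 2) ν g} := by
    refine ⟨hρ0, fun g => ?_⟩
    set m := inner' ν g (fun _ => 1) with hm
    have hV : 0 ≤ phiEnt (fun t => t ^ 2) ν g :=
      inner'_centered hsum g ▸ inner'_self_nonneg hν0 _
    have hA := inner'_centered hμsum (U g)
    rw [meanU, ← hm] at hA
    set f : α → ℝ := fun x => U g x - m with hf
    have hfmean : inner' μ f (fun _ => 1) = 0 := by
      rw [inner'_comm, hf, inner'_sub_const, inner'_comm, meanU]
      simp [inner', hμsum, hm]
    have hfU : inner' μ f f = inner' ν (D f) (fun b => g b - m) := by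
      rw [inner'_sub_const ν, meanD, ← adj]
      exact inner'_sub_const μ f (U g) m
    have hcs := inner'_sq_le hν0 (D f) (fun b => g b - m)
    rw [← hfU, inner'_centered hsum g, hA] at hcs
    have hA0 : 0 ≤ phiEnt (fun t => t ^ 2) μ (U g) := hA ▸ inner'_self_nonneg hμ0 f
    have hr := hrayleigh f hfmean
    rw [hA] at hr
    rcases hA0.eq_or_lt with h | h
    · rw [← h]; positivity
    · refine le_of_mul_le_mul_left ?_ h
      nlinarith [mul_le_mul_of_nonneg_right hr hV]
  have hinf : sInf {c | 0 ≤ c ∧ ∀ g : β → ℝ, phiEnt (fun t => t ^ 2) μ (U g) ≤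
        c * phiEnt (fun t => t ^ 2) ν g} = sSup S := by
    refine le_antisymm (csInf_le ⟨0, fun c hc => hc.1⟩ hmemρ)
      (le_csInf ⟨_, hmemρ⟩ fun c hc => csSup_le hSne ?_)
    rintro r ⟨f, h1, h2, rfl⟩
    have hcs := inner'_sq_le hμ0 f (U (D f))
    have hv := hc.2 (D f)
    rw [phiEnt_sq, phiEnt_sq, meanU, meanD, h2] at hv
    rw [adj, h1] at hcs
    rcases (inner'_self_nonneg hν0 (D f)).eq_or_lt with h | h
    · rw [← h]; exact hc.1
    · nlinarith
  rw [hinf]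
  exact isLUB_csSup hSne hSbdd

end Coupling

namespace WComplex

variable {V : Type*} [Fintype V] [DecidableEq V] {n : ℕ}

lemma pi_nonneg (K : WComplex V n) (ω : Finset V) : 0 ≤ K.pi ω := by
  by_cases h : ω ∈ K.faces
  · by_cases hc : ω.card = n
    · exact (K.pi_pos ω h hc).le
    · exact (K.pi_zero_of_card_ne ω hc).ge
  · exact (K.pi_zero_of_not_mem ω h).ge

lemma mass_nonneg (K : WComplex V n) (s : Finset V) : 0 ≤ K.mass s :=
  Finset.sum_nonneg fun ω _ => by split_ifs <;> simp [K.pi_nonneg]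

lemma mass_pos (K : WComplex V n) {s : Finset V} (hs : s ∈ K.faces) : 0 < K.mass s := by
  obtain ⟨ω, hω, hc, hsub⟩ := K.pure s hs
  refine Finset.sum_pos' (fun ω _ => by split_ifs <;> simp [K.pi_nonneg])
    ⟨ω, Finset.mem_univ _, ?_⟩
  rw [if_pos hsub]
  exact K.pi_pos ω hω hc

lemma linkPi_nonneg (K : WComplex V n) (z b : Finset V) : 0 ≤ K.linkPi z b := by
  unfold linkPi
  split_ifs
  · exact div_nonneg (K.pi_nonneg _) (K.mass_nonneg _)
  · exact le_rfl

lemma linkPi_eq_zero (K : WComplex V n) {z b : Finset V} (hb : b.card ≠ n - z.card) :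
    K.linkPi z b = 0 := by
  unfold linkPi
  split_ifs with h
  · rw [K.pi_zero_of_card_ne, zero_div]
    rw [Finset.card_union_of_disjoint h.symm]
    omega
  · rfl

lemma linkMass_eq (K : WComplex V n) (z s : Finset V) :
    K.linkMass z s = if Disjoint s z then K.mass (z ∪ s) / K.mass z else 0 := by
  unfold linkMass linkPi
  split_ifs with h
  · have e : K.mass (z ∪ s) = ∑ ω : Finset V, if z ∪ s ⊆ ω then K.pi ω else 0 := rfl
    rw [e]
    simp only [Finset.sum_div, ite_div, zero_div, ← ite_and]
    rw [← Finset.sum_filter, ← Finset.sum_filter]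
    refine Finset.sum_nbij' (fun b => z ∪ b) (fun ω => ω \ z) ?_ ?_ ?_ ?_ ?_
    · intro b hb
      simp only [Finset.mem_filter, Finset.mem_univ, true_and] at hb ⊢
      exact Finset.union_subset_union_right hb.1
    · intro ω hω
      simp only [Finset.mem_filter, Finset.mem_univ, true_and] at hω ⊢
      exact ⟨Finset.subset_sdiff.2 ⟨Finset.union_subset_right hω, h⟩, Finset.sdiff_disjoint⟩
    · intro b hb
      simp only [Finset.mem_filter, Finset.mem_univ, true_and] at hb
      exact Finset.union_sdiff_cancel_left hb.2.symm
    · intro ω hω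
      simp only [Finset.mem_filter, Finset.mem_univ, true_and] at hω
      exact Finset.union_sdiff_of_subset (Finset.union_subset_left hω)
    · intro b _
      rfl
  · refine Finset.sum_eq_zero fun b _ => ?_
    split_ifs with h1 h2
    · exact absurd (h2.mono_left h1) h
    · rfl
    · rfl

lemma linkMass_nonneg (K : WComplex V n) (z s : Finset V) : 0 ≤ K.linkMass z s :=
  Finset.sum_nonneg fun b _ => by split_ifs <;> simp [K.linkPi_nonneg]

lemma linkMass_anti (K : WComplex V n) (z : Finset V) {s t : Finset V} (h : s ⊆ t) :
    K.linkMass z t ≤ K.linkMass z s := by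
  refine Finset.sum_le_sum fun b _ => ?_
  split_ifs with h1 h2
  · exact le_rfl
  · exact absurd (h.trans h1) h2
  · exact K.linkPi_nonneg z b
  · exact le_rfl

lemma linkPi_le_linkMass (K : WComplex V n) (z : Finset V) {s b : Finset V} (h : s ⊆ b) :
    K.linkPi z b ≤ K.linkMass z s := by
  have := Finset.single_le_sum (f := fun b => if s ⊆ b then K.linkPi z b else 0)
    (fun b _ => by split_ifs <;> simp [K.linkPi_nonneg]) (Finset.mem_univ b)
  simp only [if_pos h] at this
  exact this

lemma sum_linkPi (K : WComplex V n) {z : Finset V} (hz : z ∈ K.faces) :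
    ∑ b, K.linkPi z b = 1 := by
  have h := K.linkMass_eq z ∅
  simpa [linkMass, (K.mass_pos hz).ne'] using h

lemma linkMass_eq_linkPi (K : WComplex V n) {z b : Finset V} (hb : b.card = n - z.card) :
    K.linkMass z b = K.linkPi z b := by
  unfold linkMass
  rw [Finset.sum_eq_single b]
  · simp
  · intro c _ hcb
    split_ifs with h
    · refine K.linkPi_eq_zero fun hc => hcb ?_
      exact (Finset.eq_of_subset_of_card_le h (by omega)).symm
    · rfl
  · simp

lemma linkLevel_top (K : WComplex V n) (z : Finset V) :
    K.linkLevel z (n - z.card) = K.linkPi z := by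
  funext b
  unfold linkLevel
  split_ifs with h
  · simp [K.linkMass_eq_linkPi h]
  · exact (K.linkPi_eq_zero h).symm

lemma linkVertex_eq (K : WComplex V n) {z : Finset V} (hz : z.card ≤ n) (x : V) :
    K.linkVertex z x = ((n : ℝ) - z.card)⁻¹ * K.linkMass z {x} := by
  simp [linkVertex, linkLevel, Nat.cast_sub hz]

lemma sum_card_eq_one {α : Type*} [Fintype α] (F : Finset α → ℝ)
    (hF : ∀ s : Finset α, s.card ≠ 1 → F s = 0) : ∑ s, F s = ∑ x, F {x} := by
  symm
  refine Finset.sum_of_injOn (fun x => ({x} : Finset α))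
    (fun _ _ _ _ h => Finset.singleton_injective h)
    (fun _ _ => Finset.mem_coe.2 (Finset.mem_univ _))
    (fun s _ hs => hF s fun h => hs ?_) (fun _ _ => rfl)
  obtain ⟨x, rfl⟩ := Finset.card_eq_one.1 h
  exact ⟨x, by simp⟩

lemma phiEnt_linkLevel_one (K : WComplex V n) (Φ : ℝ → ℝ) (z : Finset V) (F : Finset V → ℝ) :
    phiEnt Φ (K.linkLevel z 1) F = phiEnt Φ (K.linkVertex z) (fun x => F {x}) := by
  have h : ∀ G : Finset V → ℝ,
      expect (K.linkLevel z 1) G = expect (K.linkVertex z) (fun x => G {x}) :=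
    fun G => sum_card_eq_one _ fun s hs => by simp [linkLevel, hs]
  simp only [phiEnt, h]

lemma linkMass_pair (K : WComplex V n) {z : Finset V} (hz : z ∈ K.faces)
    (hcard : z.card + 2 ≤ n) (x y : V) :
    K.linkMass z {x, y} = ((n : ℝ) - z.card) * (K.linkVertex z x *
      (((n : ℝ) - z.card - 1) * K.linkMat z x y +
        (if x = y then 1 else 0) - (if y ∈ z then 1 else 0))) := by
  have hn : (z.card : ℝ) + 2 ≤ n := by exact_mod_cast hcard
  have hN : (n : ℝ) - z.card ≠ 0 := by linarith
  have hN1 : (n : ℝ) - z.card - 1 ≠ 0 := by linarith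
  have hm := (K.mass_pos hz).ne'
  rw [K.linkVertex_eq (by omega), mul_assoc, mul_inv_cancel_left₀ hN]
  by_cases hxz : x ∈ z
  · have h0 : K.linkMass z {x} = 0 := by simp [linkMass_eq, hxz]
    have h1 : K.linkMass z {x, y} = 0 := by simp [linkMass_eq, hxz]
    rw [h0, h1, zero_mul]
  · by_cases hxy : x = y
    · subst hxy
      simp [linkMat, hxz]
    · have hle := K.linkMass_anti z (s := {x}) (t := {x, y}) (by simp)
      have hge := K.linkMass_nonneg z {x, y}
      by_cases h0 : K.linkMass z {x} = 0
      · rw [h0, zero_mul]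
        linarith
      · have hx : K.linkMass z {x} = K.mass (z ∪ {x}) / K.mass z := by simp [linkMass_eq, hxz]
        have hx0 : K.mass (z ∪ {x}) ≠ 0 := fun h => h0 (by rw [hx, h, zero_div])
        rw [linkMat, if_pos hxy, mul_div_cancel₀ _ hN1, if_neg hxy, hx]
        by_cases hyz : y ∈ z
        · have e : z ∪ {x, y} = z ∪ {x} := by
            ext v
            simp only [Finset.mem_union, Finset.mem_insert, Finset.mem_singleton]
            grind
          have h1 : K.linkMass z {x, y} = 0 := by simp [linkMass_eq, hyz]
          rw [h1, e, if_pos hyz, div_self hx0]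
          ring
        · have h1 : K.linkMass z {x, y} = K.mass (z ∪ {x, y}) / K.mass z := by
            simp [linkMass_eq, hxz, hyz]
          rw [h1, if_neg hyz]
          field_simp
          ring

/-- The squared norm of the averaged function `b ↦ (∑ x ∈ b, f x) / (n - |z|)` is an affine
function of the quadratic form of the link random walk. -/
lemma inner'_avg_eq (K : WComplex V n) {z : Finset V} (hz : z ∈ K.faces)
    (hcard : z.card + 2 ≤ n) {f : V → ℝ} (hf : inner' (K.linkVertex z) f (fun _ => 1) = 0) :
    inner' (K.linkPi z) (fun b => (∑ x ∈ b, f x) / ((n : ℝ) - z.card))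
        (fun b => (∑ x ∈ b, f x) / ((n : ℝ) - z.card)) =
      ((n : ℝ) - z.card)⁻¹ * inner' (K.linkVertex z) f f +
        (((n : ℝ) - z.card - 1) / ((n : ℝ) - z.card)) *
          inner' (K.linkVertex z) f (mApp (K.linkMat z) f) := by
  have hn : (z.card : ℝ) + 2 ≤ n := by exact_mod_cast hcard
  have hN : (n : ℝ) - z.card ≠ 0 := by linarith
  set N : ℝ := (n : ℝ) - z.card with hNdef
  have e1 : inner' (K.linkPi z) (fun b => (∑ x ∈ b, f x) / N) (fun b => (∑ x ∈ b, f x) / N) =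
      ∑ x, ∑ y, f x * f y * K.linkMass z {x, y} / N ^ 2 := by
    have e : ∀ b, K.linkPi z b * ((∑ x ∈ b, f x) / N * ((∑ x ∈ b, f x) / N)) =
        ∑ x, ∑ y, f x * f y * (if {x, y} ⊆ b then K.linkPi z b else 0) / N ^ 2 := by
      intro b
      have hs : ∑ x ∈ b, f x = ∑ x, if x ∈ b then f x else 0 := by simp
      rw [div_mul_div_comm, hs, Finset.sum_mul_sum, Finset.sum_div, Finset.mul_sum]
      refine Finset.sum_congr rfl fun x _ => ?_
      rw [Finset.sum_div, Finset.mul_sum]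
      refine Finset.sum_congr rfl fun y _ => ?_
      by_cases hx : x ∈ b <;> by_cases hy : y ∈ b <;>
        simp [Finset.insert_subset_iff, hx, hy] <;> ring
    simp only [inner', e]
    simp only [linkMass, Finset.mul_sum, Finset.sum_div]
    rw [Finset.sum_comm]
    exact Finset.sum_congr rfl fun x _ => Finset.sum_comm
  have e2 : inner' (K.linkVertex z) f f =
      ∑ x, ∑ y, if x = y then K.linkVertex z x * (f x * f y) else 0 := by
    simp [inner']
  have e3 : inner' (K.linkVertex z) f (mApp (K.linkMat z) f) =
      ∑ x, ∑ y, K.linkVertex z x * (f x * (K.linkMat z x y * f y)) := by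
    simp only [inner', mApp, Finset.mul_sum]
  have e4 : N⁻¹ * ∑ x, ∑ y, K.linkVertex z x * (f x * 1) * (if y ∈ z then f y else 0) = 0 :=
    mul_eq_zero_of_right _ ((Finset.sum_mul_sum _ _ _ _).symm.trans (mul_eq_zero_of_left hf _))
  rw [e1, e2, e3]
  refine Eq.trans ?_ (sub_eq_self.2 e4)
  simp only [Finset.mul_sum, ← Finset.sum_sub_distrib, ← Finset.sum_add_distrib]
  refine Finset.sum_congr rfl fun x _ => Finset.sum_congr rfl fun y _ => ?_
  rw [K.linkMass_pair hz hcard, ← hNdef]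
  split_ifs <;> field_simp <;> ring

lemma exists_pair_linkVertex_pos (K : WComplex V n) {z : Finset V} (hz : z ∈ K.faces)
    (hcard : z.card + 2 ≤ n) :
    ∃ x y : V, x ≠ y ∧ 0 < K.linkVertex z x ∧ 0 < K.linkVertex z y := by
  obtain ⟨ω, hω, hc, hsub⟩ := K.pure z hz
  have hn : (z.card : ℝ) + 2 ≤ n := by exact_mod_cast hcard
  have hpos : ∀ x ∈ ω \ z, 0 < K.linkVertex z x := by
    intro x hx
    rw [Finset.mem_sdiff] at hx
    have hf : z ∪ {x} ∈ K.faces :=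
      K.down_closed ω hω _ (Finset.union_subset hsub (by simpa using hx.1))
    rw [K.linkVertex_eq (by omega), linkMass_eq, if_pos (by simpa using hx.2)]
    exact mul_pos (inv_pos.2 (by linarith)) (div_pos (K.mass_pos hf) (K.mass_pos hz))
  have hlt : 1 < (ω \ z).card := by
    rw [Finset.card_sdiff_of_subset hsub]
    omega
  obtain ⟨x, hx, y, hy, hxy⟩ := Finset.one_lt_card.1 hlt
  exact ⟨x, y, hxy, hpos x hx, hpos y hy⟩

/-- The variance contraction constant of the up-walk of the link is the largest squared norm of
the down-walk on normalized mean-zero functions. -/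
lemma isLUB_avg_sInf (K : WComplex V n) {z : Finset V} (hz : z ∈ K.faces)
    (hcard : z.card + 2 ≤ n) :
    IsLUB {r | ∃ f : V → ℝ, inner' (K.linkVertex z) f f = 1 ∧
        inner' (K.linkVertex z) f (fun _ => 1) = 0 ∧
        r = inner' (K.linkPi z) (fun b => (∑ x ∈ b, f x) / ((n : ℝ) - z.card))
          (fun b => (∑ x ∈ b, f x) / ((n : ℝ) - z.card))}
      (sInf {c | 0 ≤ c ∧ ∀ g : Finset V → ℝ,
        phiEnt (fun t => t ^ 2) (K.linkLevel z 1)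
            (mApp (K.linkUp z 1 (n - z.card)) g) ≤
          c * phiEnt (fun t => t ^ 2) (K.linkLevel z (n - z.card)) g}) := by
  have hn : (z.card : ℝ) + 2 ≤ n := by exact_mod_cast hcard
  have hN : 0 < (n : ℝ) - z.card := by linarith
  have hzn : z.card ≤ n := by omega
  have hvert : ∀ x, 0 ≤ K.linkVertex z x := fun x => by
    rw [K.linkVertex_eq hzn]
    exact mul_nonneg (inv_nonneg.2 hN.le) (K.linkMass_nonneg _ _)
  obtain ⟨x₀, y₀, hxy, hx₀, hy₀⟩ := K.exists_pair_linkVertex_pos hz hcard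
  simp only [K.phiEnt_linkLevel_one, K.linkLevel_top]
  refine isLUB_norm_sq_sInf_variance_contraction
    (w := fun x b => (if x ∈ b then K.linkPi z b else 0) / ((n : ℝ) - z.card))
    (U := fun g x => mApp (K.linkUp z 1 (n - z.card)) g {x})
    (D := fun f b => (∑ x ∈ b, f x) / ((n : ℝ) - z.card))
    ?_ ?_ ?_ (K.sum_linkPi hz) ?_ ?_ (exists_normalized_mean_zero hvert hxy hx₀ hy₀)
  · intro x b
    refine div_nonneg ?_ hN.le
    split_ifs <;> simp [K.linkPi_nonneg]
  · intro x
    rw [K.linkVertex_eq hzn, ← Finset.sum_div, inv_mul_eq_div]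
    simp [linkMass]
  · intro b
    rw [← Finset.sum_div, div_eq_iff hN.ne']
    by_cases hb : b.card = n - z.card
    · simp [hb, Nat.cast_sub hzn, mul_comm]
    · simp [K.linkPi_eq_zero hb]
  · intro g x
    rw [K.linkVertex_eq hzn, mApp, Finset.mul_sum]
    refine Finset.sum_congr rfl fun b _ => ?_
    by_cases hx : x ∈ b
    · by_cases hb : b.card = n - z.card
      · by_cases h0 : K.linkMass z {x} = 0
        · have h1 : K.linkPi z b = 0 :=
            le_antisymm (h0 ▸ K.linkPi_le_linkMass z (by simpa using hx)) (K.linkPi_nonneg z b)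
          simp [h0, h1]
        · simp only [linkUp, Finset.card_singleton, hb, Finset.singleton_subset_iff, hx,
            and_self, if_true, K.linkMass_eq_linkPi hb, Nat.choose_self, Nat.cast_one, inv_one,
            one_mul]
          field_simp
      · simp [linkUp, hb, K.linkPi_eq_zero hb]
    · simp [linkUp, hx]
  · intro f b
    simp only [ite_div, zero_div, ite_mul, zero_mul, Finset.sum_ite_mem, Finset.univ_inter,
      Finset.mul_sum, Finset.sum_div]
    exact Finset.sum_congr rfl fun x _ => by ring

end WComplex
end Expanderized

open Expanderized WComplex in
/-- For `Φ(t) = t²` (where the `Φ`-entropy is the variance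
functional and `g` ranges over all real-valued functions), the local `Φ`-entropy
contraction constant of a face `ω̂` with `|ω̂| ≤ n−2` equals
`1/(n−|ω̂|) + ((n−|ω̂|−1)/(n−|ω̂|))·λ₂(M_ω̂)`. -/
theorem statement12 {V : Type*} [Fintype V] [DecidableEq V] {n : ℕ}
    (K : WComplex V n) (z : Finset V) (hz : z ∈ K.faces) (hcard : z.card + 2 ≤ n) :
    sInf {c | 0 ≤ c ∧ ∀ g : Finset V → ℝ,
        phiEnt (fun t => t ^ 2) (K.linkLevel z 1)
            (mApp (K.linkUp z 1 (n - z.card)) g) ≤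
          c * phiEnt (fun t => t ^ 2) (K.linkLevel z (n - z.card)) g} =
      ((n : ℝ) - z.card)⁻¹ +
        (((n : ℝ) - z.card - 1) / ((n : ℝ) - z.card)) *
          lambda2 (K.linkVertex z) (K.linkMat z) := by
  have hn : (z.card : ℝ) + 2 ≤ n := by exact_mod_cast hcard
  have hN : 0 < (n : ℝ) - z.card := by linarith
  have hb : 0 < ((n : ℝ) - z.card - 1) / ((n : ℝ) - z.card) := div_pos (by linarith) hN
  set ρ := sInf {c | 0 ≤ c ∧ ∀ g : Finset V → ℝ,
        phiEnt (fun t => t ^ 2) (K.linkLevel z 1)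
            (mApp (K.linkUp z 1 (n - z.card)) g) ≤
          c * phiEnt (fun t => t ^ 2) (K.linkLevel z (n - z.card)) g}
  have hlub := K.isLUB_avg_sInf hz hcard
  set b := ((n : ℝ) - z.card - 1) / ((n : ℝ) - z.card)
  set a := ((n : ℝ) - z.card)⁻¹
  have hlub2 : IsLUB {r | ∃ f : V → ℝ, inner' (K.linkVertex z) f f = 1 ∧
      inner' (K.linkVertex z) f (fun _ => 1) = 0 ∧
      r = inner' (K.linkVertex z) f (mApp (K.linkMat z) f)} ((ρ - a) / b) := by
    constructor
    · rintro r ⟨f, h1, h2, rfl⟩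
      have h := hlub.1 ⟨f, h1, h2, rfl⟩
      rw [K.inner'_avg_eq hz hcard h2, h1, mul_one] at h
      rw [le_div_iff₀ hb]
      linarith
    · intro u hu
      have h : ρ ≤ a + b * u := by
        refine hlub.2 ?_
        rintro r ⟨f, h1, h2, rfl⟩
        rw [K.inner'_avg_eq hz hcard h2, h1, mul_one]
        have := mul_le_mul_of_nonneg_left (hu ⟨f, h1, h2, rfl⟩) hb.le
        linarith
      rw [div_le_iff₀ hb]
      linarith
  obtain ⟨x, y, hxy, hx, hy⟩ := K.exists_pair_linkVertex_pos hz hcard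
  have hvert : ∀ x, 0 ≤ K.linkVertex z x := fun x => by
    rw [K.linkVertex_eq (by omega)]
    exact mul_nonneg (inv_nonneg.2 hN.le) (K.linkMass_nonneg _ _)
  obtain ⟨f, h1, h2⟩ := exists_normalized_mean_zero hvert hxy hx hy
  rw [lambda2, hlub2.csSup_eq ⟨_, f, h1, h2, rfl⟩, mul_div_cancel₀ _ hb.ne']
  ring
end
end

section
/- Let P be a row-stochastic matrix from a finite set Ω₁ to a finite set Ω₂ with fully supported distributions μ₁ on Ω₁ and μ₂ on Ω₂ satisfying μ₁P = μ₂, and let P* be the adjoint of P with respect to (μ₁, μ₂). Then the entropy contraction constant of P is bounded below by the log-Sobolev constant of P*P: EC(P) ≥ LS(P*P). -/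
open scoped Classical
noncomputable section

namespace Expanderized

section EntropyContraction

variable {α β : Type*} [Fintype α] [Fintype β]

/-- Tangent-line bound for `t ↦ t log t` in terms of square roots. -/
lemma two_mul_sub_sqrt_mul_sqrt_le_nlog {a s : ℝ} (ha : 0 ≤ a) (hs : 0 < s) :
    2 * (a - √a * √s) + a * Real.log s ≤ nlog a := by
  rcases ha.eq_or_lt with rfl | ha
  · simp [nlog]
  have hlog := Real.one_sub_inv_le_log_of_pos (x := √a / √s) (by positivity)
  rw [Real.log_div (by positivity) (by positivity), Real.log_sqrt ha.le,
    Real.log_sqrt hs.le, inv_div] at hlog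
  have hmul := mul_le_mul_of_nonneg_left hlog ha.le
  have hdiv : a * (1 - √s / √a) = a - √a * √s := by
    have : √a ≠ 0 := by positivity
    field_simp
    linear_combination √s * Real.sq_sqrt ha.le
  rw [hdiv] at hmul
  unfold nlog
  linarith

/-- The variance identity `E[f] - (E √f)² = E[(√f - E √f)²]`. -/
lemma expect_sub_sq_expect_sqrt_eq {ν : α → ℝ} (hν : IsProbDist ν) {f : α → ℝ}
    (hf : ∀ x, 0 ≤ f x) :
    expect ν f - expect ν (fun x => √(f x)) ^ 2 =
      ∑ x, ν x * (√(f x) - expect ν (fun x => √(f x))) ^ 2 := by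
  set m := expect ν (fun x => √(f x))
  have h : ∀ x, ν x * (√(f x) - m) ^ 2 =
      ν x * f x - 2 * m * (ν x * √(f x)) + m ^ 2 * ν x := fun x => by
    linear_combination ν x * Real.sq_sqrt (hf x)
  simp_rw [h, Finset.sum_add_distrib, Finset.sum_sub_distrib, ← Finset.mul_sum, hν.2]
  change _ = expect ν f - 2 * m * m + m ^ 2 * 1
  ring

lemma expect_sub_sq_expect_sqrt_nonneg {ν : α → ℝ} (hν : IsProbDist ν) {f : α → ℝ}
    (hf : ∀ x, 0 ≤ f x) : 0 ≤ expect ν f - expect ν (fun x => √(f x)) ^ 2 := by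
  rw [expect_sub_sq_expect_sqrt_eq hν hf]
  exact Finset.sum_nonneg fun x _ => mul_nonneg (hν.1 x) (sq_nonneg _)

/-- The entropy of `f` dominates the variance of `√f`. -/
lemma expect_sub_sq_expect_sqrt_le_ent {ν : α → ℝ} (hν : IsProbDist ν) {f : α → ℝ}
    (hf : ∀ x, 0 ≤ f x) :
    expect ν f - expect ν (fun x => √(f x)) ^ 2 ≤ ent ν f := by
  have hnonneg : ∀ x ∈ Finset.univ, 0 ≤ ν x * f x := fun x _ => mul_nonneg (hν.1 x) (hf x)
  rcases (show 0 ≤ expect ν f from Finset.sum_nonneg hnonneg).eq_or_lt with h0 | hpos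
  · have hzero : ∀ x, ν x * f x = 0 := fun x =>
      (Finset.sum_eq_zero_iff_of_nonneg hnonneg).1 h0.symm x (Finset.mem_univ x)
    have hent : ent ν f = 0 := by
      unfold ent phiEnt
      rw [← h0]
      simp [expect, nlog, ← mul_assoc, hzero]
    rw [hent, ← h0]
    linarith [sq_nonneg (expect ν (fun x => √(f x)))]
  · set s := expect ν f with hs
    set m := expect ν (fun x => √(f x)) with hm
    have hsum : ∑ x, ν x * (2 * (f x - √(f x) * √s) + f x * Real.log s) ≤
        expect ν (fun x => nlog (f x)) :=
      Finset.sum_le_sum fun x _ =>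
        mul_le_mul_of_nonneg_left (two_mul_sub_sqrt_mul_sqrt_le_nlog (hf x) hpos) (hν.1 x)
    have hexp : ∑ x, ν x * (2 * (f x - √(f x) * √s) + f x * Real.log s) =
        (2 + Real.log s) * s - 2 * √s * m := by
      rw [hs, hm]
      unfold expect
      rw [Finset.mul_sum, Finset.mul_sum, ← Finset.sum_sub_distrib]
      exact Finset.sum_congr rfl fun x _ => by ring
    change _ ≤ expect ν (fun x => nlog (f x)) - s * Real.log s
    nlinarith [sq_nonneg (√s - m), Real.sq_sqrt hpos.le]

lemma ent_nonneg {ν : α → ℝ} (hν : IsProbDist ν) {f : α → ℝ} (hf : ∀ x, 0 ≤ f x) :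
    0 ≤ ent ν f :=
  (expect_sub_sq_expect_sqrt_nonneg hν hf).trans (expect_sub_sq_expect_sqrt_le_ent hν hf)

lemma expect_rowMul (μ : α → ℝ) (P : α → β → ℝ) (f : β → ℝ) :
    expect (rowMul μ P) f = expect μ (mApp P f) := by
  unfold expect rowMul mApp
  simp_rw [Finset.sum_mul, Finset.mul_sum]
  rw [Finset.sum_comm]
  exact Finset.sum_congr rfl fun x _ => Finset.sum_congr rfl fun y _ => by ring

/-- The chain rule for entropy. -/
lemma ent_rowMul (μ : α → ℝ) (P : α → β → ℝ) (f : β → ℝ) :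
    ent (rowMul μ P) f = ent μ (mApp P f) + expect μ (fun x => ent (P x) f) := by
  unfold ent phiEnt
  rw [expect_rowMul, expect_rowMul]
  have h : expect μ (fun x => expect (P x) (fun y => nlog (f y)) - nlog (expect (P x) f)) =
      expect μ (mApp P fun y => nlog (f y)) - expect μ (fun x => nlog (mApp P f x)) := by
    simp only [expect, mApp, mul_sub, Finset.sum_sub_distrib]
  rw [h]
  ring

lemma inner'_mApp_adjointKer {μ₁ : α → ℝ} {μ₂ : β → ℝ} (hμ₂ : ∀ y, μ₂ y ≠ 0)
    (P : α → β → ℝ) (g : β → ℝ) :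
    inner' μ₂ g (mApp (matMul (adjointKer μ₁ μ₂ P) P) g) =
      inner' μ₁ (mApp P g) (mApp P g) := by
  have hl : inner' μ₂ g (mApp (matMul (adjointKer μ₁ μ₂ P) P) g) =
      ∑ y, ∑ z, ∑ x, μ₁ x * (P x y * g y) * (P x z * g z) := by
    unfold inner' mApp matMul adjointKer
    simp_rw [Finset.sum_mul, Finset.mul_sum]
    refine Finset.sum_congr rfl fun y _ => Finset.sum_congr rfl fun z _ =>
      Finset.sum_congr rfl fun x _ => ?_
    have := hμ₂ y
    field_simp
  have hr : inner' μ₁ (mApp P g) (mApp P g) =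
      ∑ x, ∑ y, ∑ z, μ₁ x * (P x y * g y) * (P x z * g z) := by
    unfold inner' mApp
    simp_rw [Finset.sum_mul_sum, Finset.mul_sum, mul_assoc]
  rw [hl, hr, Finset.sum_comm (γ := α)]
  exact Finset.sum_congr rfl fun y _ => Finset.sum_comm

/-- The Dirichlet form of `P*P` at `√f` is the average of the variances of `√f` under the
rows of `P`. -/
lemma dirichlet_adjointKer_sqrt {μ₁ : α → ℝ} {μ₂ : β → ℝ} (hμ₂ : ∀ y, μ₂ y ≠ 0)
    {P : α → β → ℝ} (hP : rowMul μ₁ P = μ₂) {f : β → ℝ} (hf : ∀ y, 0 ≤ f y) :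
    inner' μ₂ (fun y => √(f y)) (fun y => √(f y) -
        mApp (matMul (adjointKer μ₁ μ₂ P) P) (fun y => √(f y)) y) =
      expect μ₁ (fun x => expect (P x) f - expect (P x) (fun y => √(f y)) ^ 2) := by
  have hl : inner' μ₂ (fun y => √(f y)) (fun y => √(f y) -
        mApp (matMul (adjointKer μ₁ μ₂ P) P) (fun y => √(f y)) y) =
      expect μ₂ f - inner' μ₂ (fun y => √(f y))
        (mApp (matMul (adjointKer μ₁ μ₂ P) P) (fun y => √(f y))) := by
    simp only [inner', expect, mul_sub, Finset.sum_sub_distrib, Real.mul_self_sqrt (hf _)]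
  rw [hl, inner'_mApp_adjointKer hμ₂, ← hP, expect_rowMul]
  simp only [inner', expect, mApp, mul_sub, Finset.sum_sub_distrib, sq]

/-- Entropy contraction in terms of the Dirichlet form of `P*P`. -/
lemma ent_mApp_add_dirichlet_le {μ₁ : α → ℝ} {μ₂ : β → ℝ} (hμ₁ : ∀ x, 0 ≤ μ₁ x)
    (hμ₂ : ∀ y, μ₂ y ≠ 0) {P : α → β → ℝ} (hPs : IsRowStochastic P)
    (hP : rowMul μ₁ P = μ₂) {f : β → ℝ} (hf : ∀ y, 0 ≤ f y) :
    ent μ₁ (mApp P f) + inner' μ₂ (fun y => √(f y)) (fun y => √(f y) -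
        mApp (matMul (adjointKer μ₁ μ₂ P) P) (fun y => √(f y)) y) ≤ ent μ₂ f := by
  rw [dirichlet_adjointKer_sqrt hμ₂ hP hf, ← hP, ent_rowMul]
  gcongr
  exact Finset.sum_le_sum fun x _ => mul_le_mul_of_nonneg_left
    (expect_sub_sq_expect_sqrt_le_ent ⟨hPs.1 x, hPs.2 x⟩ hf) (hμ₁ x)

lemma dirichlet_adjointKer_nonneg {μ₁ : α → ℝ} {μ₂ : β → ℝ} (hμ₁ : ∀ x, 0 ≤ μ₁ x)
    (hμ₂ : ∀ y, μ₂ y ≠ 0) {P : α → β → ℝ} (hPs : IsRowStochastic P)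
    (hP : rowMul μ₁ P = μ₂) {g : β → ℝ} (hg : ∀ y, 0 ≤ g y) :
    0 ≤ inner' μ₂ g (fun y => g y - mApp (matMul (adjointKer μ₁ μ₂ P) P) g y) := by
  have h := dirichlet_adjointKer_sqrt hμ₂ hP (f := fun y => g y ^ 2) fun y => sq_nonneg _
  simp only [Real.sqrt_sq (hg _)] at h
  rw [h]
  refine Finset.sum_nonneg fun x _ => mul_nonneg (hμ₁ x) ?_
  have hvar := expect_sub_sq_expect_sqrt_nonneg (f := fun y => g y ^ 2)
    ⟨hPs.1 x, hPs.2 x⟩ fun y => sq_nonneg _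
  simpa only [Real.sqrt_sq (hg _)] using hvar

end EntropyContraction

end Expanderized

open Expanderized in
/-- For a row-stochastic `P` with `μ₁P = μ₂` and adjoint `P*`
with respect to `(μ₁, μ₂)`, the entropy contraction constant of `P` is bounded
below by the log-Sobolev constant of `P*P`: `EC(P) ≥ LS(P*P)`. -/
theorem statement14 {Ω₁ Ω₂ : Type*} [Fintype Ω₁] [Fintype Ω₂]
    (μ₁ : Ω₁ → ℝ) (μ₂ : Ω₂ → ℝ)
    (hμ₁ : IsProbDist μ₁) (hμ₁pos : ∀ x, 0 < μ₁ x)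
    (hμ₂ : IsProbDist μ₂) (hμ₂pos : ∀ y, 0 < μ₂ y)
    (P : Ω₁ → Ω₂ → ℝ) (hP : IsRowStochastic P) (hPstat : rowMul μ₁ P = μ₂) :
    LS μ₂ (matMul (adjointKer μ₁ μ₂ P) P) ≤ EC μ₁ μ₂ P := by
  have hne : ∀ y, μ₂ y ≠ 0 := fun y => (hμ₂pos y).ne'
  by_cases htriv : ∀ f : Ω₂ → ℝ, (∀ y, 0 ≤ f y) → ent μ₂ f = 0
  · have hunbdd : ¬ BddAbove {C : ℝ | 0 ≤ C ∧ ∀ f : Ω₂ → ℝ, (∀ x, 0 ≤ f x) →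
        C * ent μ₂ (fun x => f x ^ 2) ≤
          inner' μ₂ f (fun x => f x - mApp (matMul (adjointKer μ₁ μ₂ P) P) f x)} := by
      rintro ⟨B, hB⟩
      have := hB (a := |B| + 1) ⟨by positivity, fun f hf => by
        rw [htriv _ fun y => sq_nonneg (f y), mul_zero]
        exact dirichlet_adjointKer_nonneg hμ₁.1 hne hP hPstat hf⟩
      linarith [le_abs_self B]
    unfold LS
    rw [Real.sSup_of_not_bddAbove hunbdd]
    exact Real.sSup_nonneg fun C hC => hC.1
  · push Not at htriv
    obtain ⟨f₀, hf₀, hent⟩ := htriv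
    have hpos : 0 < ent μ₂ f₀ := (ent_nonneg hμ₂ hf₀).lt_of_ne' hent
    refine Real.sSup_le (fun C hC => le_csSup ⟨1, fun D hD => ?_⟩ ⟨hC.1, fun f hf => ?_⟩)
      (Real.sSup_nonneg fun C hC => hC.1)
    · have hPf : 0 ≤ ent μ₁ (mApp P f₀) := ent_nonneg hμ₁ fun x =>
        Finset.sum_nonneg fun y _ => mul_nonneg (hP.1 x y) (hf₀ y)
      have := nonneg_of_mul_nonneg_left (hPf.trans (hD.2 f₀ hf₀)) hpos
      linarith
    · have hLS := hC.2 (fun y => √(f y)) fun y => Real.sqrt_nonneg _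
      simp only [Real.sq_sqrt (hf _)] at hLS
      have hdec := ent_mApp_add_dirichlet_le hμ₁.1 hne hP hPstat hf
      change ent μ₁ (mApp P f) ≤ (1 - C) * ent μ₂ f
      linarith
end
end

section
/- Let P be a row-stochastic matrix from a finite set Ω₁ to a finite set Ω₂ and let f : Ω₂ → ℝ≥0. Writing η(ω₂) = f(ω₂)²·log(f(ω₂)²) (with 0·log 0 = 0), one has, for every ω₁ ∈ Ω₁, [Pη](ω₁) ≥ [Pf²](ω₁)·log([Pf²](ω₁)) + [Pf²](ω₁) − ([Pf](ω₁))². -/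
open scoped Classical
noncomputable section

namespace Expanderized

/-- The tangent bound for `nlog (t ^ 2)` at scale `s`, from `log u ≥ 1 - 1 / u` at `u = t / s`. -/
lemma le_nlog_sq {s t : ℝ} (hs : 0 < s) (ht : 0 ≤ t) :
    t ^ 2 * Real.log (s ^ 2) + 2 * t ^ 2 - 2 * s * t ≤ nlog (t ^ 2) := by
  rcases ht.eq_or_lt with rfl | ht
  · simp [nlog]
  have h := Real.one_sub_inv_le_log_of_pos (div_pos ht hs)
  rw [Real.log_div ht.ne' hs.ne', inv_div] at h
  have h2 := mul_le_mul_of_nonneg_left h (by positivity : 0 ≤ 2 * t ^ 2)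
  have h3 : 2 * t ^ 2 * (1 - s / t) = 2 * t ^ 2 - 2 * s * t := by
    field_simp
  rw [nlog, Real.log_pow, Real.log_pow]
  push_cast
  linarith

end Expanderized

open Expanderized in
/-- For a row-stochastic `P` and `f ≥ 0`, writing
`η = f²·log f²` (with `0·log 0 = 0`), for every `ω₁`:
`[Pη](ω₁) ≥ [Pf²](ω₁)·log([Pf²](ω₁)) + [Pf²](ω₁) − ([Pf](ω₁))²`. -/
theorem statement15 {Ω₁ Ω₂ : Type*} [Fintype Ω₁] [Fintype Ω₂]
    (P : Ω₁ → Ω₂ → ℝ) (hP : IsRowStochastic P)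
    (f : Ω₂ → ℝ) (hf : ∀ y, 0 ≤ f y) :
    ∀ x : Ω₁,
      nlog (mApp P (fun y => f y ^ 2) x) + mApp P (fun y => f y ^ 2) x -
          (mApp P f x) ^ 2 ≤
        mApp P (fun y => nlog (f y ^ 2)) x := by
  intro x
  obtain ⟨hP0, -⟩ := hP
  have ha : 0 ≤ mApp P (fun y => f y ^ 2) x :=
    Finset.sum_nonneg fun y _ => mul_nonneg (hP0 x y) (sq_nonneg _)
  rcases ha.eq_or_lt with ha | ha
  · have hterm : ∀ y, P x y * f y ^ 2 = 0 := fun y =>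
      (Finset.sum_eq_zero_iff_of_nonneg fun y _ => mul_nonneg (hP0 x y) (sq_nonneg _)).mp
        ha.symm y (Finset.mem_univ y)
    have hη : mApp P (fun y => nlog (f y ^ 2)) x = 0 :=
      Finset.sum_eq_zero fun y _ => by simp only [nlog, ← mul_assoc, hterm, zero_mul]
    rw [hη, ← ha, nlog]
    linarith [sq_nonneg (mApp P f x)]
  · set a := mApp P (fun y => f y ^ 2) x with ha_def
    have hs : 0 < √a := Real.sqrt_pos.mpr ha
    have hsq : √a ^ 2 = a := Real.sq_sqrt ha.le
    have hsum : a * Real.log a + 2 * a - 2 * √a * mApp P f x ≤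
        mApp P (fun y => nlog (f y ^ 2)) x := by
      calc a * Real.log a + 2 * a - 2 * √a * mApp P f x
          = ∑ y, P x y * (f y ^ 2 * Real.log a + 2 * f y ^ 2 - 2 * √a * f y) := by
            simp only [mul_sub, mul_add, Finset.sum_sub_distrib, Finset.sum_add_distrib]
            congr 1
            · congr 1
              · simp only [ha_def, mApp, Finset.sum_mul, mul_assoc]
              · simp only [ha_def, mApp, Finset.mul_sum, mul_left_comm]
            · simp only [mApp, Finset.mul_sum]
              exact Finset.sum_congr rfl fun y _ => by ring
        _ ≤ mApp P (fun y => nlog (f y ^ 2)) x :=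
            Finset.sum_le_sum fun y _ => mul_le_mul_of_nonneg_left
              (by simpa only [hsq] using le_nlog_sq hs (hf y)) (hP0 x y)
    rw [nlog]
    linarith [sq_nonneg (√a - mApp P f x)]
end
end
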